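/- Under the stated Bessel transformation property and the Hecke relations, for every integer l ≥ 0 and every integer m > 0, setting M = (−p·w_p)^l · p^{−4(l+m)}, one has: B(h(l,m)·t₁) = −M/p, B(h(l,m)·t₂) = M/p², B(h(l,m)·t₃) = −M/p, B(h(l,m)·t₄) = M, B(h(l,m)·t₅) = M, B(h(l,m)·t₆) = −p·M, B(h(l,m)·t₇) = M/p², B(h(l,m)·t₈) = −M/p³. -/

import Mathlib

open Matrix

noncomputable section

variable (p : ℕ) [Fact p.Prime]

/-- The 4×4 symplectic similitude matrix `J`. -/
def Jmat : Matrix (Fin 4) (Fin 4) ℚ_[p] :=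
  !![0,0,1,0; 0,0,0,1; -1,0,0,0; 0,-1,0,0]

/-- `GSp₄(ℚ_p)`. -/
def GSp4 : Set (Matrix (Fin 4) (Fin 4) ℚ_[p]) :=
  {g | IsUnit g.det ∧ ∃ μ : ℚ_[p]ˣ, gᵀ * Jmat p * g = (μ : ℚ_[p]) • Jmat p}

/-- `K_p = GSp₄(ℤ_p)`, viewed inside `GSp₄(ℚ_p)`. -/
def Kp : Set (Matrix (Fin 4) (Fin 4) ℚ_[p]) :=
  {g | g ∈ GSp4 p ∧ (∀ i j, ‖g i j‖ ≤ 1) ∧ ‖g.det‖ = 1}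

/-- The Iwahori subgroup `I_p`: elements of `K_p` whose reduction mod `p` has zero
entries at positions (1,2), (3,1), (3,2), (4,1), (4,2), (4,3) (0-indexed below). -/
def Ip : Set (Matrix (Fin 4) (Fin 4) ℚ_[p]) :=
  {g | g ∈ Kp p ∧ ‖g 0 1‖ < 1 ∧ ‖g 2 0‖ < 1 ∧ ‖g 2 1‖ < 1 ∧
      ‖g 3 0‖ < 1 ∧ ‖g 3 1‖ < 1 ∧ ‖g 3 2‖ < 1}

/-- The matrix `U_x` for `x = (n,q,r)`. -/
def Umat (n q r : ℚ_[p]) : Matrix (Fin 4) (Fin 4) ℚ_[p] :=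
  !![1,0,n,q; 0,1,q,r; 0,0,1,0; 0,0,0,1]

/-- The matrix `Z_y` for `y ∈ ℤ_p`. -/
def Zmat (y : ℚ_[p]) : Matrix (Fin 4) (Fin 4) ℚ_[p] :=
  !![1,y,0,0; 0,1,0,0; 0,0,1,0; 0,0,-y,1]

/-- The matrix `Z_∞`. -/
def Zinf : Matrix (Fin 4) (Fin 4) ℚ_[p] :=
  !![0,1,0,0; 1,0,0,0; 0,0,0,1; 0,0,1,0]

/-- `Z_v` for `v ∈ V = Y ∪ {∞}`, where `Y = {0,…,p−1}` is modelled by `Fin p`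
and `∞` by `none`. -/
def ZV : Option (Fin p) → Matrix (Fin 4) (Fin 4) ℚ_[p]
  | some y => Zmat p (y.val : ℚ_[p])
  | none => Zinf p

/-- Class A matrices `A_x^y = U_x · J · Z_y`. -/
def Amat (x : Fin p × Fin p × Fin p) (v : Option (Fin p)) : Matrix (Fin 4) (Fin 4) ℚ_[p] :=
  Umat p (x.1.val : ℚ_[p]) (x.2.1.val : ℚ_[p]) (x.2.2.val : ℚ_[p]) * Jmat p * ZV p v

/-- Class B matrices `B_x^y = J · U_x · J · Z_y`. -/
def Bmat (x : Fin p × Fin p × Fin p) (v : Option (Fin p)) : Matrix (Fin 4) (Fin 4) ℚ_[p] :=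
  Jmat p * Umat p (x.1.val : ℚ_[p]) (x.2.1.val : ℚ_[p]) (x.2.2.val : ℚ_[p]) * Jmat p * ZV p v

/-- Assemble a 4×4 matrix from 2×2 blocks. -/
def blk (A B C D : Matrix (Fin 2) (Fin 2) ℚ_[p]) : Matrix (Fin 4) (Fin 4) ℚ_[p] :=
  Matrix.reindex finSumFinEquiv finSumFinEquiv (fromBlocks A B C D)

variable (a b c : ℚ_[p])

/-- The matrix `S = (a, b/2; b/2, c)`. -/
def Smat : Matrix (Fin 2) (Fin 2) ℚ_[p] := !![a, b/2; b/2, c]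

/-- The matrix `ξ = (b/2, c; −a, −b/2)`. -/
def xiS : Matrix (Fin 2) (Fin 2) ℚ_[p] := !![b/2, c; -a, -b/2]

/-- The torus `T(ℚ_p) = {g ∈ GL₂(ℚ_p) : gᵀSg = det(g)·S}`. -/
def Tgrp : Set (Matrix (Fin 2) (Fin 2) ℚ_[p]) :=
  {g | IsUnit g.det ∧ gᵀ * Smat p a b c * g = g.det • Smat p a b c}

/-- The embedding `g ↦ diag(g, det(g)·(g⁻¹)ᵀ)` of `GL₂` into `GSp₄`. -/
def emb (g : Matrix (Fin 2) (Fin 2) ℚ_[p]) : Matrix (Fin 4) (Fin 4) ℚ_[p] :=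
  blk p g 0 0 (g.det • (g⁻¹)ᵀ)

/-- The unipotent group `U(ℚ_p)`. -/
def Ugrp : Set (Matrix (Fin 4) (Fin 4) ℚ_[p]) :=
  {u | ∃ X : Matrix (Fin 2) (Fin 2) ℚ_[p], Xᵀ = X ∧ u = blk p 1 X 0 1}

/-- The Bessel group `R(ℚ_p) = T(ℚ_p)·U(ℚ_p)` inside `GSp₄(ℚ_p)`. -/
def Rgrp : Set (Matrix (Fin 4) (Fin 4) ℚ_[p]) :=
  {r | ∃ t ∈ Tgrp p a b c, ∃ u ∈ Ugrp p, r = emb p t * u}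

/-- `h(l,m) = diag(p^{2m+l}, p^{m+l}, 1, p^m)`. -/
def hmat (l : ℤ) (m : ℕ) : Matrix (Fin 4) (Fin 4) ℚ_[p] :=
  diagonal ![(p : ℚ_[p]) ^ (2 * (m : ℤ) + l), (p : ℚ_[p]) ^ ((m : ℤ) + l), 1, (p : ℚ_[p]) ^ (m : ℤ)]

/-- `(l,m)`-equivalence: `f ~ g` iff `r·h(l,m)·f·k = h(l,m)·g` for some
`r ∈ R(ℚ_p)`, `k ∈ I_p`. -/
def LMEquiv (l : ℤ) (m : ℕ) (f g : Matrix (Fin 4) (Fin 4) ℚ_[p]) : Prop :=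
  ∃ r ∈ Rgrp p a b c, ∃ k ∈ Ip p, r * hmat p l m * f * k = hmat p l m * g

/-- `t₁ = B_{(1,0,0)}^0`. -/
def t1 : Matrix (Fin 4) (Fin 4) ℚ_[p] := Jmat p * Umat p 1 0 0 * Jmat p * Zmat p 0
/-- `t₂ = B_{(1,0,0)}^∞`. -/
def t2 : Matrix (Fin 4) (Fin 4) ℚ_[p] := Jmat p * Umat p 1 0 0 * Jmat p * Zinf p
/-- `t₃ = B_{(0,0,1)}^0`. -/
def t3 : Matrix (Fin 4) (Fin 4) ℚ_[p] := Jmat p * Umat p 0 0 1 * Jmat p * Zmat p 0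
/-- `t₄ = B_{(0,0,1)}^∞`. -/
def t4 : Matrix (Fin 4) (Fin 4) ℚ_[p] := Jmat p * Umat p 0 0 1 * Jmat p * Zinf p
/-- `t₅ = B_{(0,0,0)}^0`. -/
def t5 : Matrix (Fin 4) (Fin 4) ℚ_[p] := Jmat p * Umat p 0 0 0 * Jmat p * Zmat p 0
/-- `t₆ = B_{(0,0,0)}^∞`. -/
def t6 : Matrix (Fin 4) (Fin 4) ℚ_[p] := Jmat p * Umat p 0 0 0 * Jmat p * Zinf p
/-- `t₇ = A_{(0,0,0)}^0`. -/
def t7 : Matrix (Fin 4) (Fin 4) ℚ_[p] := Umat p 0 0 0 * Jmat p * Zmat p 0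
/-- `t₈ = A_{(0,0,0)}^∞`. -/
def t8 : Matrix (Fin 4) (Fin 4) ℚ_[p] := Umat p 0 0 0 * Jmat p * Zinf p

/-- `T_m`: `{t₁,…,t₈}` if `m > 0`, and `{t₁, t₂, t₅, t₇}` if `m = 0`. -/
def TsetM (m : ℕ) : Set (Matrix (Fin 4) (Fin 4) ℚ_[p]) :=
  if m = 0 then {t1 p, t2 p, t5 p, t7 p}
  else {t1 p, t2 p, t3 p, t4 p, t5 p, t6 p, t7 p, t8 p}

/-- `GL₂(ℤ_p)` viewed inside `GL₂(ℚ_p)`: integral entries and unit determinant. -/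
def GL2Z : Set (Matrix (Fin 2) (Fin 2) ℚ_[p]) :=
  {g | (∀ i j, ‖g i j‖ ≤ 1) ∧ ‖g.det‖ = 1}

/-- The Atkin–Lehner element `η_p`. -/
def etamat : Matrix (Fin 4) (Fin 4) ℚ_[p] :=
  !![0,0,0,1; 0,0,1,0; 0,(p:ℚ_[p]),0,0; (p:ℚ_[p]),0,0,0]

/-- `R_y` for `y ∈ V`: `R_y = (U_{(y,0,0)})ᵀ` for `y ∈ Y` and the given matrix for `y = ∞`. -/
def RV : Option (Fin p) → Matrix (Fin 4) (Fin 4) ℚ_[p]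
  | some y => (Umat p (y.val : ℚ_[p]) 0 0)ᵀ
  | none => !![0,0,-1,0; 0,-1,0,0; -1,0,0,0; 0,0,0,1]

/-- Representative `R_∞` of the nontrivial coset. -/
def Rinf : Matrix (Fin 4) (Fin 4) ℚ_[p] :=
  !![0,0,-1,0; 0,-1,0,0; -1,0,0,0; 0,0,0,1]

section Values

variable {p}

/-- A `4 × 4` integral symplectic similitude with unit multiplier and the right vanishing
pattern mod `p` lies in the Iwahori subgroup. -/
lemma mem_Ip_of_similitude {g : Matrix (Fin 4) (Fin 4) ℚ_[p]} (μ : ℚ_[p]) (hμ : ‖μ‖ = 1)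
    (h : gᵀ * Jmat p * g = μ • Jmat p) (hint : ∀ i j, ‖g i j‖ ≤ 1)
    (hlt : ‖g 0 1‖ < 1 ∧ ‖g 2 0‖ < 1 ∧ ‖g 2 1‖ < 1 ∧ ‖g 3 0‖ < 1 ∧ ‖g 3 1‖ < 1 ∧ ‖g 3 2‖ < 1) :
    g ∈ Ip p := by
  have hJ : (Jmat p).det = 1 := by
    simp [Jmat, Matrix.det_succ_row_zero, Fin.sum_univ_succ, Fin.succAbove]
  have hdet : ‖g.det‖ = 1 := by
    have h1 := congrArg (fun A => ‖A.det‖) h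
    simp only [det_mul, det_transpose, hJ, det_smul, Fintype.card_fin, norm_mul, norm_pow, hμ,
      one_pow, mul_one] at h1
    nlinarith [norm_nonneg g.det]
  have hμ0 : μ ≠ 0 := by rintro rfl; simp at hμ
  have hg0 : g.det ≠ 0 := by intro h0; simp [h0] at hdet
  exact ⟨⟨⟨hg0.isUnit, Units.mk0 μ hμ0, h⟩, hint, hdet⟩, hlt⟩

lemma diagonal_mem_Ip (x₀ x₁ x₂ x₃ : ℚ_[p]) (h : x₀ * x₂ = x₁ * x₃)
    (h₀ : ‖x₀‖ = 1) (h₁ : ‖x₁‖ = 1) (h₂ : ‖x₂‖ = 1) (h₃ : ‖x₃‖ = 1) :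
    !![x₀,0,0,0; 0,x₁,0,0; 0,0,x₂,0; 0,0,0,x₃] ∈ Ip p := by
  refine mem_Ip_of_similitude (x₀ * x₂) (by simp [h₀, h₂]) ?_ ?_ (by simp)
  · ext i j
    fin_cases i <;> fin_cases j <;>
      simp [Jmat, Matrix.mul_apply, Fin.sum_univ_four, mul_comm x₂, mul_comm x₃, h]
  · intro i j
    fin_cases i <;> fin_cases j <;> simp [h₀.le, h₁.le, h₂.le, h₃.le]

lemma one_mem_Ip : (1 : Matrix (Fin 4) (Fin 4) ℚ_[p]) ∈ Ip p := by
  have h := diagonal_mem_Ip (p := p) 1 1 1 1 rfl (by simp) (by simp) (by simp) (by simp)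
  convert h using 1
  ext i j
  fin_cases i <;> fin_cases j <;> simp

lemma Zmat_eq_mul_Zinf (y : ℚ_[p]) (hy : y ≠ 0) :
    Zmat p y = !![1,0,0,0; y⁻¹,1,0,0; 0,0,1,-y⁻¹; 0,0,0,1] * Zinf p *
      !![-y⁻¹,0,0,0; 1,y,0,0; 0,0,-y,1; 0,0,0,y⁻¹] := by
  ext i j
  fin_cases i <;> fin_cases j <;>
    simp [Zmat, Zinf, Matrix.mul_apply, Fin.sum_univ_four, hy]

lemma RV_some_eq_mul_Rinf (y : ℚ_[p]) (hy : y ≠ 0) :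
    (Umat p y 0 0)ᵀ = Umat p y⁻¹ 0 0 * Rinf p *
      !![-y,0,-1,0; 0,-1,0,0; 0,0,y⁻¹,0; 0,0,0,1] := by
  ext i j
  fin_cases i <;> fin_cases j <;>
    simp [Umat, Rinf, Matrix.mul_apply, Fin.sum_univ_four, hy]

lemma Zmat_factor_mem_Ip (y : ℚ_[p]) (hy : ‖y‖ = 1) :
    !![-y⁻¹,0,0,0; 1,y,0,0; 0,0,-y,1; 0,0,0,y⁻¹] ∈ Ip p := by
  have hy0 : y ≠ 0 := by rintro rfl; simp at hy
  refine mem_Ip_of_similitude 1 (by simp) ?_ ?_ (by simp)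
  · ext i j
    fin_cases i <;> fin_cases j <;>
      simp [Jmat, Matrix.mul_apply, Fin.sum_univ_four, hy0]
  · intro i j
    fin_cases i <;> fin_cases j <;> simp [hy]

lemma RV_factor_mem_Ip (y : ℚ_[p]) (hy : ‖y‖ = 1) :
    !![-y,0,-1,0; 0,-1,0,0; 0,0,y⁻¹,0; 0,0,0,1] ∈ Ip p := by
  have hy0 : y ≠ 0 := by rintro rfl; simp at hy
  refine mem_Ip_of_similitude (-1) (by simp) ?_ ?_ (by simp)
  · ext i j
    fin_cases i <;> fin_cases j <;>
      simp [Jmat, Matrix.mul_apply, Fin.sum_univ_four, hy0]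
  · intro i j
    fin_cases i <;> fin_cases j <;> simp [hy]

lemma norm_natCast_fin (y : Fin p) (hy : (y : ℕ) ≠ 0) : ‖((y : ℕ) : ℚ_[p])‖ = 1 := by
  rw [Padic.norm_natCast_eq_one_iff]
  exact Nat.coprime_of_lt_prime hy y.isLt Fact.out

lemma hmat_natCast (l m : ℕ) :
    hmat p (l : ℤ) m = !![(p : ℚ_[p]) ^ (2 * m + l),0,0,0; 0,(p : ℚ_[p]) ^ (m + l),0,0;
      0,0,1,0; 0,0,0,(p : ℚ_[p]) ^ m] := by
  have h1 : (2 * (m : ℤ) + l) = ((2 * m + l : ℕ) : ℤ) := by push_cast; ring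
  have h2 : ((m : ℤ) + l) = ((m + l : ℕ) : ℤ) := by push_cast; ring
  unfold hmat
  rw [h1, h2]
  simp only [zpow_natCast]
  ext i j
  fin_cases i <;> fin_cases j <;> simp

lemma hmat_mul_Umat (l m : ℕ) (n q r : ℚ_[p]) :
    hmat p (l : ℤ) m * Umat p n q r =
      Umat p (p ^ (2 * m + l) * n) (p ^ (m + l) * q) (p ^ l * r) * hmat p (l : ℤ) m := by
  rw [hmat_natCast]
  ext i j
  fin_cases i <;> fin_cases j <;>
    simp [Umat, Matrix.mul_apply, Fin.sum_univ_four] <;> ring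

lemma Umat_eq_blk (n q r : ℚ_[p]) : Umat p n q r = blk p 1 !![n, q; q, r] 0 1 := by
  ext i j
  fin_cases i <;> fin_cases j <;> simp [Umat, blk, fromBlocks, finSumFinEquiv, Fin.addCases]

lemma blk_one : blk p 1 0 0 1 = 1 := by
  simp [blk]

lemma emb_one : emb p 1 = 1 := by
  simp [emb, blk_one]

lemma sum_option_fin_eq (f : Option (Fin p) → ℂ) (hsum : ∑ v, f v = 0) (x : ℂ)
    (h0 : ∀ y : Fin p, (y : ℕ) = 0 → f (some y) = x)
    (h : ∀ y : Fin p, (y : ℕ) ≠ 0 → f (some y) = f none) :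
    f none = -x / p := by
  have hp : 0 < p := (Fact.out : p.Prime).pos
  have hp0 : (p : ℂ) ≠ 0 := by exact_mod_cast hp.ne'
  have hsplit : ∀ y : Fin p, f (some y) = f none + if y = ⟨0, hp⟩ then x - f none else 0 := by
    intro y
    by_cases hy : (y : ℕ) = 0
    · rw [if_pos (Fin.ext hy), h0 y hy]; ring
    · rw [if_neg (fun h' => hy (congrArg Fin.val h')), h y hy, add_zero]
  rw [Fintype.sum_option, Finset.sum_congr rfl (fun y _ => hsplit y), Finset.sum_add_distrib,
    Finset.sum_ite_eq' Finset.univ] at hsum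
  simp only [Finset.sum_const, Finset.card_univ, Fintype.card_fin, nsmul_eq_mul, Finset.mem_univ,
    if_true] at hsum
  rw [eq_div_iff hp0]
  linear_combination hsum

/-- The right `I_p`-invariance, left unipotent invariance on the cosets `h(l,m) * g`, and Hecke
relations of a Bessel function attached to an unramified twist of the Steinberg representation. -/
structure IsSteinbergBessel (B : Matrix (Fin 4) (Fin 4) ℚ_[p] → ℂ) (w : ℂ) : Prop where
  unip : ∀ (l m : ℕ) (n q r : ℚ_[p]), ‖n‖ ≤ 1 → ‖q‖ ≤ 1 → ‖r‖ ≤ 1 →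
    ∀ (W : Matrix (Fin 4) (Fin 4) ℚ_[p]), ∀ k ∈ Ip p,
      B (hmat p (l : ℤ) m * (Umat p n q r * W * k)) = B (hmat p (l : ℤ) m * W)
  torus : ∀ (l m : ℕ), 0 < m → ∀ v : ℚ_[p], ‖v‖ ≤ 1 →
    B (hmat p (l : ℤ) m * Zmat p v) = B (hmat p (l : ℤ) m)
  sum_ZV : ∀ g : Matrix (Fin 4) (Fin 4) ℚ_[p], ∑ v : Option (Fin p), B (g * ZV p v) = 0
  eta : ∀ g : Matrix (Fin 4) (Fin 4) ℚ_[p], B (g * etamat p) = w * B g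
  sum_RV : ∀ g : Matrix (Fin 4) (Fin 4) ℚ_[p], ∑ v : Option (Fin p), B (g * RV p v) = 0

lemma Umat_zero : Umat p 0 0 0 = 1 := by
  ext i j
  fin_cases i <;> fin_cases j <;> simp [Umat]

lemma Zmat_zero : Zmat p 0 = 1 := by
  ext i j
  fin_cases i <;> fin_cases j <;> simp [Zmat]

lemma Zinf_mul_Umat (n q r : ℚ_[p]) : Zinf p * Umat p n q r = Umat p r q n * Zinf p := by
  ext i j
  fin_cases i <;> fin_cases j <;> simp [Umat, Zinf, Matrix.mul_apply, Fin.sum_univ_four]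

lemma Rinf_mul_Umat (r : ℚ_[p]) : Rinf p * Umat p 0 0 r = Umat p 0 0 (-r) * Rinf p := by
  ext i j
  fin_cases i <;> fin_cases j <;> simp [Umat, Rinf, Matrix.mul_apply, Fin.sum_univ_four]

lemma Rinf_mul_lower (z : ℚ_[p]) :
    Rinf p * !![1,0,0,0; z,1,0,0; 0,0,1,-z; 0,0,0,1] = Umat p 0 z 0 * Rinf p := by
  ext i j
  fin_cases i <;> fin_cases j <;> simp [Umat, Rinf, Matrix.mul_apply, Fin.sum_univ_four]

namespace IsSteinbergBessel

variable {B : Matrix (Fin 4) (Fin 4) ℚ_[p] → ℂ} {w : ℂ}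

lemma right_inv (hB : IsSteinbergBessel B w) (l m : ℕ) (W : Matrix (Fin 4) (Fin 4) ℚ_[p])
    {k : Matrix (Fin 4) (Fin 4) ℚ_[p]} (hk : k ∈ Ip p) :
    B (hmat p (l : ℤ) m * (W * k)) = B (hmat p (l : ℤ) m * W) := by
  have h := hB.unip l m 0 0 0 (by simp) (by simp) (by simp) W k hk
  rwa [Umat_zero, one_mul] at h

lemma apply_mul_Zinf (hB : IsSteinbergBessel B w) (l m : ℕ) (W : Matrix (Fin 4) (Fin 4) ℚ_[p])
    (hW : ∀ z : ℚ_[p], W * !![1,0,0,0; z,1,0,0; 0,0,1,-z; 0,0,0,1] = Umat p 0 z 0 * W) :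
    B (hmat p (l : ℤ) m * (W * Zinf p)) = -B (hmat p (l : ℤ) m * W) / p := by
  rw [← mul_assoc]
  refine sum_option_fin_eq (fun v => B (hmat p (l : ℤ) m * W * ZV p v)) (hB.sum_ZV _) _ ?_ ?_
  · intro y hy
    simp [ZV, hy, Zmat_zero]
  · intro y hy
    have h1 := norm_natCast_fin y hy
    have h0 : ((y : ℕ) : ℚ_[p]) ≠ 0 := by exact_mod_cast hy
    simp only [ZV]
    rw [Zmat_eq_mul_Zinf _ h0, mul_assoc, ← mul_assoc W, ← mul_assoc W, hW, mul_assoc (Umat p _ _ _),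
      hB.unip l m _ _ _ (by simp) (by simp [h1]) (by simp) _ _ (Zmat_factor_mem_Ip _ h1), mul_assoc]

lemma apply_mul_Rinf (hB : IsSteinbergBessel B w) (l m : ℕ) (W : Matrix (Fin 4) (Fin 4) ℚ_[p])
    (hW : ∀ z : ℚ_[p], ‖z‖ ≤ 1 → ∃ n r : ℚ_[p], ‖n‖ ≤ 1 ∧ ‖r‖ ≤ 1 ∧
      W * Umat p z 0 0 = Umat p n 0 r * W) :
    B (hmat p (l : ℤ) m * (W * Rinf p)) = -B (hmat p (l : ℤ) m * W) / p := by
  rw [← mul_assoc]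
  refine sum_option_fin_eq (fun v => B (hmat p (l : ℤ) m * W * RV p v)) (hB.sum_RV _) _ ?_ ?_
  · intro y hy
    simp [RV, hy, Umat_zero]
  · intro y hy
    have h1 := norm_natCast_fin y hy
    have h0 : ((y : ℕ) : ℚ_[p]) ≠ 0 := by exact_mod_cast hy
    obtain ⟨n, r, hn, hr, h⟩ := hW (y : ℚ_[p])⁻¹ (by simp [h1])
    have hinf : RV p none = Rinf p := rfl
    simp only [hinf]
    simp only [RV]
    rw [RV_some_eq_mul_Rinf _ h0, mul_assoc, ← mul_assoc W, ← mul_assoc W, h, mul_assoc (Umat p _ _ _),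
      hB.unip l m _ _ _ hn (by simp) hr _ _ (RV_factor_mem_Ip _ h1), mul_assoc]

lemma apply_R (hB : IsSteinbergBessel B w) (l m : ℕ) :
    B (hmat p (l : ℤ) m * Rinf p) = -B (hmat p (l : ℤ) m) / p := by
  have h := hB.apply_mul_Rinf l m 1 fun z hz => ⟨z, 0, hz, by simp, by simp⟩
  rwa [one_mul, mul_one] at h

lemma apply_RZ (hB : IsSteinbergBessel B w) (l m : ℕ) :
    B (hmat p (l : ℤ) m * (Rinf p * Zinf p)) = B (hmat p (l : ℤ) m) / p ^ 2 := by
  rw [hB.apply_mul_Zinf l m _ Rinf_mul_lower, hB.apply_R]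
  ring

lemma apply_RZR (hB : IsSteinbergBessel B w) (l m : ℕ) :
    B (hmat p (l : ℤ) m * (Rinf p * Zinf p * Rinf p)) = -B (hmat p (l : ℤ) m) / p ^ 3 := by
  rw [hB.apply_mul_Rinf l m _ fun z hz => ⟨0, -z, by simp, by simpa using hz, ?_⟩, hB.apply_RZ]
  · ring
  · rw [mul_assoc, Zinf_mul_Umat, ← mul_assoc, Rinf_mul_Umat, mul_assoc]

lemma apply_Z (hB : IsSteinbergBessel B w) (l m : ℕ) (hm : 0 < m) :
    B (hmat p (l : ℤ) m * Zinf p) = -p * B (hmat p (l : ℤ) m) := by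
  have h := hB.sum_ZV (hmat p (l : ℤ) m)
  simp only [Fintype.sum_option, ZV] at h
  rw [Finset.sum_congr rfl fun y _ => hB.torus l m hm _ (by simpa using Padic.norm_int_le_one ((y : ℕ) : ℤ))] at h
  simp only [Finset.sum_const, Finset.card_univ, Fintype.card_fin, nsmul_eq_mul] at h
  linear_combination h

lemma apply_ZR (hB : IsSteinbergBessel B w) (l m : ℕ) (hm : 0 < m) :
    B (hmat p (l : ℤ) m * (Zinf p * Rinf p)) = B (hmat p (l : ℤ) m) := by
  have hp0 : (p : ℂ) ≠ 0 := by exact_mod_cast (Fact.out : p.Prime).ne_zero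
  rw [hB.apply_mul_Rinf l m _ fun z hz => ⟨0, z, by simp, hz, Zinf_mul_Umat z 0 0⟩,
    hB.apply_Z l m hm]
  field_simp

lemma apply_ZRZ (hB : IsSteinbergBessel B w) (l m : ℕ) (hm : 0 < m) :
    B (hmat p (l : ℤ) m * (Zinf p * Rinf p * Zinf p)) = -B (hmat p (l : ℤ) m) / p := by
  rw [hB.apply_mul_Zinf l m _ fun z => ?_, hB.apply_ZR l m hm]
  rw [mul_assoc, Rinf_mul_lower, ← mul_assoc, Zinf_mul_Umat, mul_assoc]

lemma apply_ZRZR (hB : IsSteinbergBessel B w) (l m : ℕ) (hm : 0 < m) :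
    B (hmat p (l : ℤ) m * (Zinf p * Rinf p * Zinf p * Rinf p)) =
      B (hmat p (l : ℤ) m) / p ^ 2 := by
  rw [hB.apply_mul_Rinf l m _ fun z hz => ⟨-z, 0, by simpa using hz, by simp, ?_⟩,
    hB.apply_ZRZ l m hm]
  · ring
  · rw [mul_assoc, Zinf_mul_Umat, ← mul_assoc, mul_assoc (Zinf p), Rinf_mul_Umat, ← mul_assoc,
      Zinf_mul_Umat, mul_assoc, mul_assoc, mul_assoc]

lemma apply_hmat_succ_left (hB : IsSteinbergBessel B w) (l m : ℕ) :
    B (hmat p ((l + 1 : ℕ) : ℤ) m) = -w * B (hmat p (l : ℤ) m) / p ^ 3 := by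
  have hk : !![-1,0,0,0; 0,1,0,0; 0,0,1,0; 0,0,0,-1] ∈ Ip p :=
    diagonal_mem_Ip (-1) 1 1 (-1) (by simp) (by simp) (by simp) (by simp) (by simp)
  have h : hmat p ((l + 1 : ℕ) : ℤ) m =
      hmat p (l : ℤ) m * (Rinf p * Zinf p * Rinf p *
        !![-1,0,0,0; 0,1,0,0; 0,0,1,0; 0,0,0,-1]) * etamat p := by
    rw [hmat_natCast, hmat_natCast]
    ext i j
    fin_cases i <;> fin_cases j <;>
      simp [Rinf, Zinf, etamat, Matrix.mul_apply, Fin.sum_univ_four] <;> ring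
  rw [h, hB.eta, hB.right_inv l m _ hk, hB.apply_RZR]
  ring

lemma apply_hmat_zero_succ (hB : IsSteinbergBessel B w) (hw : w ^ 2 = 1) (m : ℕ) :
    B (hmat p ((0 : ℕ) : ℤ) (m + 1)) = B (hmat p ((0 : ℕ) : ℤ) m) / p ^ 4 := by
  have hp0 : (p : ℂ) ≠ 0 := by exact_mod_cast (Fact.out : p.Prime).ne_zero
  have hk : !![1,0,0,0; 0,-1,0,0; 0,0,-1,0; 0,0,0,1] ∈ Ip p :=
    diagonal_mem_Ip 1 (-1) (-1) 1 (by simp) (by simp) (by simp) (by simp) (by simp)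
  have h : hmat p ((0 : ℕ) : ℤ) (m + 1) * (Zinf p * Rinf p * Zinf p *
        !![1,0,0,0; 0,-1,0,0; 0,0,-1,0; 0,0,0,1]) =
      hmat p ((1 : ℕ) : ℤ) m * (Rinf p * Zinf p) * etamat p := by
    rw [hmat_natCast, hmat_natCast]
    ext i j
    fin_cases i <;> fin_cases j <;>
      simp [Rinf, Zinf, etamat, Matrix.mul_apply, Fin.sum_univ_four] <;> ring
  have h' := congrArg B h
  rw [hB.right_inv 0 _ _ hk, hB.apply_ZRZ 0 _ m.succ_pos, hB.eta, hB.apply_RZ,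
    hB.apply_hmat_succ_left 0 m] at h'
  field_simp at h' ⊢
  linear_combination (-1 : ℂ) * h' + B (hmat p ((0 : ℕ) : ℤ) m) * hw

lemma apply_hmat (hB : IsSteinbergBessel B w) (hw : w ^ 2 = 1) (h1 : B 1 = 1) (l m : ℕ) :
    B (hmat p (l : ℤ) m) = (-(p : ℂ) * w) ^ l * (p : ℂ) ^ (-(4 * ((l : ℤ) + (m : ℤ)))) := by
  have hp0 : (p : ℂ) ≠ 0 := by exact_mod_cast (Fact.out : p.Prime).ne_zero
  induction l with
  | zero =>
    induction m with
    | zero =>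
      have h : hmat p ((0 : ℕ) : ℤ) 0 = 1 := by
        rw [hmat_natCast]
        ext i j
        fin_cases i <;> fin_cases j <;> simp
      rw [h, h1]
      simp
    | succ m ih =>
      rw [hB.apply_hmat_zero_succ hw, ih]
      have he : -(4 * (((0 : ℕ) : ℤ) + ((m + 1 : ℕ) : ℤ))) =
          -(4 * (((0 : ℕ) : ℤ) + (m : ℤ))) - (4 : ℕ) := by push_cast; ring
      rw [he, zpow_sub₀ hp0, zpow_natCast]
      ring
  | succ l ih =>
    rw [hB.apply_hmat_succ_left, ih]
    have he : -(4 * (((l + 1 : ℕ) : ℤ) + (m : ℤ))) =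
        -(4 * ((l : ℤ) + (m : ℤ))) - (4 : ℕ) := by push_cast; ring
    rw [he, zpow_sub₀ hp0, zpow_natCast]
    field_simp
    ring

lemma of_equivariant (a b c : ℚ_[p]) (ha : ‖a‖ = 1) (hb : ‖b‖ ≤ 1) (hc : ‖c‖ = 1)
    (ψ : ℚ_[p] → ℂ) (Λ : Matrix (Fin 2) (Fin 2) ℚ_[p] → ℂ)
    (hψtriv : ∀ x : ℚ_[p], ‖x‖ ≤ 1 → ψ x = 1)
    (hΛscalar : ∀ z : ℚ_[p], z ≠ 0 → Λ (z • (1 : Matrix (Fin 2) (Fin 2) ℚ_[p])) = 1)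
    (hΛtriv : ∀ x y : ℚ_[p], ‖x‖ ≤ 1 → ‖y‖ < 1 →
      (x • (1 : Matrix (Fin 2) (Fin 2) ℚ_[p]) + y • xiS p a b c) ∈ GL2Z p →
      Λ (x • (1 : Matrix (Fin 2) (Fin 2) ℚ_[p]) + y • xiS p a b c) = 1)
    (hBessel : ∀ t ∈ Tgrp p a b c, ∀ X : Matrix (Fin 2) (Fin 2) ℚ_[p], Xᵀ = X →
      ∀ g : Matrix (Fin 4) (Fin 4) ℚ_[p], ∀ k ∈ Ip p,
      B (emb p t * blk p 1 X 0 1 * g * k) = Λ t * ψ ((Smat p a b c * X).trace) * B g)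
    (hHZ : ∀ g : Matrix (Fin 4) (Fin 4) ℚ_[p], ∑ v : Option (Fin p), B (g * ZV p v) = 0)
    (hHeta : ∀ g : Matrix (Fin 4) (Fin 4) ℚ_[p], B (g * etamat p) = w * B g)
    (hHR : ∀ g : Matrix (Fin 4) (Fin 4) ℚ_[p], ∑ v : Option (Fin p), B (g * RV p v) = 0) :
    IsSteinbergBessel B w := by
  have hsub : ∀ x y : ℚ_[p], ‖x - y‖ ≤ max ‖x‖ ‖y‖ := fun x y => by
    rw [sub_eq_add_neg, ← norm_neg y]; exact IsUltrametricDist.norm_add_le_max _ _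
  have hp1 : ∀ n : ℕ, ‖(p : ℚ_[p]) ^ n‖ ≤ 1 := fun n => by
    rw [norm_pow]; exact pow_le_one₀ (norm_nonneg _) Padic.norm_p_lt_one.le
  have hunip : ∀ (l m : ℕ) (n q r : ℚ_[p]), ‖n‖ ≤ 1 → ‖q‖ ≤ 1 → ‖r‖ ≤ 1 →
      ∀ (W : Matrix (Fin 4) (Fin 4) ℚ_[p]), ∀ k ∈ Ip p,
      B (hmat p (l : ℤ) m * (Umat p n q r * W * k)) = B (hmat p (l : ℤ) m * W) := by
    intro l m n q r hn hq hr W k hk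
    have hΛ : Λ 1 = 1 := by simpa using hΛscalar 1 one_ne_zero
    have h1 : (1 : Matrix (Fin 2) (Fin 2) ℚ_[p]) ∈ Tgrp p a b c := by simp [Tgrp]
    rw [← mul_assoc, ← mul_assoc, hmat_mul_Umat, Umat_eq_blk, mul_assoc (blk p _ _ _ _)]
    have h := hBessel 1 h1 !![p ^ (2 * m + l) * n, p ^ (m + l) * q; p ^ (m + l) * q, p ^ l * r]
      (by ext i j; fin_cases i <;> fin_cases j <;> rfl) (hmat p (l : ℤ) m * W) k hk
    rw [emb_one, one_mul, hΛ, hψtriv, one_mul, one_mul] at h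
    · exact h
    · have htr : (Smat p a b c * !![p ^ (2 * m + l) * n, p ^ (m + l) * q;
          p ^ (m + l) * q, p ^ l * r]).trace =
          a * (p ^ (2 * m + l) * n) + b * (p ^ (m + l) * q) + c * (p ^ l * r) := by
        simp [Smat, Matrix.trace_fin_two]
        ring
      rw [htr]
      have hle : ∀ (s x : ℚ_[p]) (k : ℕ), ‖s‖ ≤ 1 → ‖x‖ ≤ 1 → ‖s * (p ^ k * x)‖ ≤ 1 := by
        intro s x k hs hx
        rw [norm_mul, norm_mul]
        exact mul_le_one₀ hs (by positivity) (mul_le_one₀ (hp1 k) (norm_nonneg _) hx)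
      refine (IsUltrametricDist.norm_add_le_max _ _).trans (max_le ?_ (hle _ _ _ hc.le hr))
      exact (IsUltrametricDist.norm_add_le_max _ _).trans
        (max_le (hle _ _ _ ha.le hn) (hle _ _ _ hb hq))
  refine ⟨hunip, ?_, hHZ, hHeta, hHR⟩
  intro l m hm v hv
  have hc0 : c ≠ 0 := by rintro rfl; simp at hc
  have hppos : (p : ℚ_[p]) ≠ 0 := by exact_mod_cast (Fact.out : p.Prime).ne_zero
  have hpm : ‖(p : ℚ_[p]) ^ m‖ ≤ ‖(p : ℚ_[p])‖ := by
    rw [norm_pow]; exact pow_le_of_le_one (norm_nonneg _) Padic.norm_p_lt_one.le hm.ne'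
  obtain ⟨y, hy⟩ : ∃ y : ℚ_[p], y = p ^ m * v / c := ⟨_, rfl⟩
  have hyc : y * c = p ^ m * v := by rw [hy]; field_simp
  have hyp : ‖y‖ ≤ ‖(p : ℚ_[p])‖ := by
    rw [hy, norm_div, hc, div_one, norm_mul]
    exact (mul_le_of_le_one_right (norm_nonneg _) hv).trans hpm
  have hy1 : ‖y‖ < 1 := hyp.trans_lt Padic.norm_p_lt_one
  obtain ⟨α, hα⟩ : ∃ α : ℚ_[p], α = p ^ m * a * y := ⟨_, rfl⟩
  have hα1 : ‖α‖ < 1 := by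
    rw [hα, norm_mul, norm_mul, ha, mul_one]
    exact (mul_le_of_le_one_left (norm_nonneg _) (hp1 m)).trans_lt hy1
  have hvα1 : ‖v * α‖ < 1 := by
    rw [norm_mul]; exact (mul_le_of_le_one_left (norm_nonneg _) hv).trans_lt hα1
  have hby1 : ‖b * y‖ < 1 := by
    rw [norm_mul]; exact (mul_le_of_le_one_left (norm_nonneg _) hb).trans_lt hy1
  have hvby1 : ‖v * (b * y)‖ < 1 := by
    rw [norm_mul]; exact (mul_le_of_le_one_left (norm_nonneg _) hv).trans_lt hby1
  have hone : ∀ e : ℚ_[p], ‖e‖ < 1 → ‖1 + e‖ = 1 := by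
    intro e he
    rw [Padic.add_eq_max_of_ne (by rw [norm_one]; exact he.ne'), norm_one, max_eq_left he.le]
  have hμ : ‖1 + (v * α - b * y)‖ = 1 :=
    hone _ ((hsub _ _).trans_lt (max_lt hvα1 hby1))
  have hyca : p ^ m * v * (a * y) = v * α := by rw [hα]; ring
  have ht : (1 - y * b / 2) • (1 : Matrix (Fin 2) (Fin 2) ℚ_[p]) + y • xiS p a b c =
      !![1, p ^ m * v; -(a * y), 1 - b * y] := by
    rw [← hyc]
    ext i j
    fin_cases i <;> fin_cases j <;> simp [xiS] <;> ring
  have hdet : (!![1, p ^ m * v; -(a * y), 1 - b * y]).det = 1 + (v * α - b * y) := by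
    rw [Matrix.det_fin_two_of]; linear_combination hyca
  have hdet0 : 1 + (v * α - b * y) ≠ 0 := by intro h; simp [h] at hμ
  have hT : !![1, p ^ m * v; -(a * y), 1 - b * y] ∈ Tgrp p a b c := by
    refine ⟨by rw [hdet]; exact hdet0.isUnit, ?_⟩
    rw [Matrix.det_fin_two_of, ← hyc]
    ext i j
    fin_cases i <;> fin_cases j <;>
      simp [Smat, Matrix.mul_apply, Fin.sum_univ_two] <;> ring
  have hGL : !![1, p ^ m * v; -(a * y), 1 - b * y] ∈ GL2Z p := by
    refine ⟨?_, by rw [hdet]; exact hμ⟩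
    have h1 : ‖(p : ℚ_[p]) ^ m * v‖ ≤ 1 := by
      rw [norm_mul]; exact mul_le_one₀ (hp1 m) (norm_nonneg _) hv
    have h2 : ‖1 - b * y‖ ≤ 1 := by
      rw [sub_eq_add_neg]; exact (hone _ (by rwa [norm_neg])).le
    intro i j
    fin_cases i <;> fin_cases j
    · simp
    · simpa using h1
    · simpa [ha] using hy1.le
    · simpa using h2
  have hx : ‖1 - y * b / 2‖ ≤ 1 := by
    have h2 : ‖(p : ℚ_[p])‖ ≤ ‖(2 : ℚ_[p])‖ := by
      by_cases h : p = 2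
      · subst h; simp
      · have : ‖((2 : ℕ) : ℚ_[p])‖ = 1 := by
          rw [Padic.norm_natCast_eq_one_iff]
          exact (Nat.coprime_primes Fact.out Nat.prime_two).2 h
        rw [Nat.cast_ofNat] at this
        rw [this]
        exact Padic.norm_p_lt_one.le
    refine (hsub _ _).trans (max_le (by simp) ?_)
    rw [norm_div, norm_mul]
    exact div_le_one_of_le₀ ((mul_le_of_le_one_right (norm_nonneg _) hb).trans (hyp.trans h2))
      (norm_nonneg _)
  have hΛt : Λ !![1, p ^ m * v; -(a * y), 1 - b * y] = 1 := by
    rw [← ht]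
    exact hΛtriv _ _ hx hy1 (ht ▸ hGL)
  have hk : !![1 + v * α, v * (b * y),0,0; -α, 1 - b * y,0,0; 0,0,1 - b * y,α;
      0,0,-(v * (b * y)),1 + v * α] ∈ Ip p := by
    refine mem_Ip_of_similitude (1 + (v * α - b * y)) hμ ?_ ?_ ?_
    · ext i j
      fin_cases i <;> fin_cases j <;>
        simp [Jmat, Matrix.mul_apply, Fin.sum_univ_four] <;> ring
    · have h1 := (hone _ hvα1).le
      have h2 : ‖1 - b * y‖ ≤ 1 := by
        rw [sub_eq_add_neg]; exact (hone _ (by rwa [norm_neg])).le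
      have h3 := hvby1.le
      rw [norm_mul, norm_mul] at h3
      intro i j
      fin_cases i <;> fin_cases j <;> simp [h1, h2, h3, hα1.le]
    · have h3 := hvby1
      rw [norm_mul, norm_mul] at h3
      simp [h3]
  have hmat_eq : emb p !![1, p ^ m * v; -(a * y), 1 - b * y] * hmat p (l : ℤ) m =
      hmat p (l : ℤ) m * (Zmat p v * !![1 + v * α, v * (b * y),0,0; -α, 1 - b * y,0,0;
        0,0,1 - b * y,α; 0,0,-(v * (b * y)),1 + v * α]) := by
    have hadj : (!![1, p ^ m * v; -(a * y), 1 - b * y]).det •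
        (!![1, p ^ m * v; -(a * y), 1 - b * y])⁻¹ᵀ =
        !![1 - b * y, a * y; -(p ^ m * v), 1] := by
      rw [Matrix.inv_def, Ring.inverse_eq_inv', transpose_smul, smul_smul, hdet,
        mul_inv_cancel₀ hdet0, one_smul, Matrix.adjugate_fin_two_of]
      ext i j
      fin_cases i <;> fin_cases j <;> simp
    rw [emb, hadj, hmat_natCast, hα]
    ext i j
    fin_cases i <;> fin_cases j <;>
      simp [blk, Zmat, fromBlocks, finSumFinEquiv, Fin.addCases, Matrix.mul_apply,
        Fin.sum_univ_four] <;> ring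
  have h := hBessel _ hT 0 (by simp) (hmat p (l : ℤ) m) 1 one_mem_Ip
  rw [blk_one, mul_one, mul_one, mul_zero, trace_zero, hψtriv 0 (by simp), hΛt, one_mul, one_mul,
    hmat_eq] at h
  rw [← h]
  have h' := hunip l m 0 0 0 (by simp) (by simp) (by simp) (Zmat p v) _ hk
  rw [Umat_zero, one_mul] at h'
  exact h'.symm

end IsSteinbergBessel

lemma t1_eq : t1 p = Umat p (-1) 0 0 * Rinf p *
    !![-1,0,1,0; 0,1,0,0; 0,0,1,0; 0,0,0,-1] := by
  ext i j
  fin_cases i <;> fin_cases j <;>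
    simp [t1, Jmat, Umat, Rinf, Zmat, Matrix.mul_apply, Fin.sum_univ_four]

lemma t2_eq : t2 p = Umat p (-1) 0 0 * (Rinf p * Zinf p) *
    !![1,0,0,0; 0,-1,0,1; 0,0,-1,0; 0,0,0,1] := by
  ext i j
  fin_cases i <;> fin_cases j <;>
    simp [t2, Jmat, Umat, Rinf, Zinf, Matrix.mul_apply, Fin.sum_univ_four]

lemma t3_eq : t3 p = Umat p 0 0 (-1) * (Zinf p * Rinf p * Zinf p) *
    !![1,0,0,0; 0,-1,0,1; 0,0,-1,0; 0,0,0,1] := by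
  ext i j
  fin_cases i <;> fin_cases j <;>
    simp [t3, Jmat, Umat, Rinf, Zinf, Zmat, Matrix.mul_apply, Fin.sum_univ_four]

lemma t4_eq : t4 p = Umat p 0 0 (-1) * (Zinf p * Rinf p) *
    !![-1,0,1,0; 0,1,0,0; 0,0,1,0; 0,0,0,-1] := by
  ext i j
  fin_cases i <;> fin_cases j <;>
    simp [t4, Jmat, Umat, Rinf, Zinf, Matrix.mul_apply, Fin.sum_univ_four]

lemma t5_eq : t5 p = 1 * !![-1,0,0,0; 0,-1,0,0; 0,0,-1,0; 0,0,0,-1] := by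
  ext i j
  fin_cases i <;> fin_cases j <;>
    simp [t5, Jmat, Umat, Zmat, Matrix.mul_apply, Fin.sum_univ_four]

lemma t6_eq : t6 p = Zinf p * !![-1,0,0,0; 0,-1,0,0; 0,0,-1,0; 0,0,0,-1] := by
  ext i j
  fin_cases i <;> fin_cases j <;>
    simp [t6, Jmat, Umat, Zinf, Matrix.mul_apply, Fin.sum_univ_four]

lemma t7_eq : t7 p = Zinf p * Rinf p * Zinf p * Rinf p *
    !![1,0,0,0; 0,-1,0,0; 0,0,1,0; 0,0,0,-1] := by
  ext i j
  fin_cases i <;> fin_cases j <;>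
    simp [t7, Jmat, Umat, Zmat, Zinf, Rinf, Matrix.mul_apply, Fin.sum_univ_four]

lemma t8_eq : t8 p = Rinf p * Zinf p * Rinf p *
    !![1,0,0,0; 0,-1,0,0; 0,0,1,0; 0,0,0,-1] := by
  ext i j
  fin_cases i <;> fin_cases j <;>
    simp [t8, Jmat, Umat, Zinf, Rinf, Matrix.mul_apply, Fin.sum_univ_four]

lemma t1_factor_mem_Ip :
    !![-1,0,1,0; 0,1,0,0; 0,0,1,0; 0,0,0,-1] ∈ Ip p := by
  refine mem_Ip_of_similitude (-1) (by simp) ?_ ?_ (by simp)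
  · ext i j
    fin_cases i <;> fin_cases j <;> simp [Jmat, Matrix.mul_apply, Fin.sum_univ_four]
  · intro i j
    fin_cases i <;> fin_cases j <;> simp

lemma t2_factor_mem_Ip :
    !![1,0,0,0; 0,-1,0,1; 0,0,-1,0; 0,0,0,1] ∈ Ip p := by
  refine mem_Ip_of_similitude (-1) (by simp) ?_ ?_ (by simp)
  · ext i j
    fin_cases i <;> fin_cases j <;> simp [Jmat, Matrix.mul_apply, Fin.sum_univ_four]
  · intro i j
    fin_cases i <;> fin_cases j <;> simp

end Values

theorem bessel_values_m_pos
    (ha : ‖a‖ = 1) (hb : ‖b‖ ≤ 1) (hc : ‖c‖ = 1)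
    (hd : ‖b ^ 2 - 4 * a * c‖ = 1)
    (hnsq : ∀ z : ℚ_[p], z ^ 2 ≠ b ^ 2 - 4 * a * c)
    (B : Matrix (Fin 4) (Fin 4) ℚ_[p] → ℂ) (ψ : ℚ_[p] → ℂ)
    (Λ : Matrix (Fin 2) (Fin 2) ℚ_[p] → ℂ)
    (hψadd : ∀ x y : ℚ_[p], ψ (x + y) = ψ x * ψ y)
    (hψtriv : ∀ x : ℚ_[p], ‖x‖ ≤ 1 → ψ x = 1)
    (hψnontriv : ∃ x : ℚ_[p], ‖x‖ ≤ p ∧ ψ x ≠ 1)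
    (hΛmul : ∀ s t, s ∈ Tgrp p a b c → t ∈ Tgrp p a b c → Λ (s * t) = Λ s * Λ t)
    (hΛne : ∀ t ∈ Tgrp p a b c, Λ t ≠ 0)
    (hΛscalar : ∀ z : ℚ_[p], z ≠ 0 → Λ (z • (1 : Matrix (Fin 2) (Fin 2) ℚ_[p])) = 1)
    (hΛtriv : ∀ x y : ℚ_[p], ‖x‖ ≤ 1 → ‖y‖ < 1 →
      (x • (1 : Matrix (Fin 2) (Fin 2) ℚ_[p]) + y • xiS p a b c) ∈ GL2Z p →
      Λ (x • (1 : Matrix (Fin 2) (Fin 2) ℚ_[p]) + y • xiS p a b c) = 1)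
    (hBessel : ∀ t ∈ Tgrp p a b c, ∀ X : Matrix (Fin 2) (Fin 2) ℚ_[p], Xᵀ = X →
      ∀ g : Matrix (Fin 4) (Fin 4) ℚ_[p], ∀ k ∈ Ip p,
      B (emb p t * blk p 1 X 0 1 * g * k) = Λ t * ψ ((Smat p a b c * X).trace) * B g)
    (hB1 : B 1 = 1) (w : ℂ) (hw : w = 1 ∨ w = -1)
    (hHZ : ∀ g : Matrix (Fin 4) (Fin 4) ℚ_[p], ∑ v : Option (Fin p), B (g * ZV p v) = 0)
    (hHeta : ∀ g : Matrix (Fin 4) (Fin 4) ℚ_[p], B (g * etamat p) = w * B g)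
    (hHR : ∀ g : Matrix (Fin 4) (Fin 4) ℚ_[p], ∑ v : Option (Fin p), B (g * RV p v) = 0) :
    ∀ (l m : ℕ), 0 < m → ∀ M : ℂ,
      M = (-(p : ℂ) * w) ^ l * (p : ℂ) ^ (-(4 * ((l : ℤ) + (m : ℤ)))) →
      B (hmat p (l : ℤ) m * t1 p) = -M / p ∧
      B (hmat p (l : ℤ) m * t2 p) = M / (p : ℂ) ^ 2 ∧
      B (hmat p (l : ℤ) m * t3 p) = -M / p ∧
      B (hmat p (l : ℤ) m * t4 p) = M ∧
      B (hmat p (l : ℤ) m * t5 p) = M ∧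
      B (hmat p (l : ℤ) m * t6 p) = -(p : ℂ) * M ∧
      B (hmat p (l : ℤ) m * t7 p) = M / (p : ℂ) ^ 2 ∧
      B (hmat p (l : ℤ) m * t8 p) = -M / (p : ℂ) ^ 3 := by
  have hw2 : w ^ 2 = 1 := by rcases hw with rfl | rfl <;> norm_num
  have hS : IsSteinbergBessel B w := .of_equivariant a b c ha hb hc ψ Λ hψtriv hΛscalar hΛtriv
    hBessel hHZ hHeta hHR
  intro l m hm M hM
  have hB : B (hmat p (l : ℤ) m) = M := by rw [hM, hS.apply_hmat hw2 hB1]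
  have hneg : !![-1,0,0,0; 0,-1,0,0; 0,0,-1,0; 0,0,0,-1] ∈ Ip p :=
    diagonal_mem_Ip (-1) (-1) (-1) (-1) rfl (by simp) (by simp) (by simp) (by simp)
  have halt : !![1,0,0,0; 0,-1,0,0; 0,0,1,0; 0,0,0,-1] ∈ Ip p :=
    diagonal_mem_Ip 1 (-1) 1 (-1) (by simp) (by simp) (by simp) (by simp) (by simp)
  refine ⟨?_, ?_, ?_, ?_, ?_, ?_, ?_, ?_⟩
  · rw [t1_eq, hS.unip l m _ _ _ (by simp) (by simp) (by simp) _ _ t1_factor_mem_Ip,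
      hS.apply_R, hB]
  · rw [t2_eq, hS.unip l m _ _ _ (by simp) (by simp) (by simp) _ _ t2_factor_mem_Ip,
      hS.apply_RZ, hB]
  · rw [t3_eq, hS.unip l m _ _ _ (by simp) (by simp) (by simp) _ _ t2_factor_mem_Ip,
      hS.apply_ZRZ l m hm, hB]
  · rw [t4_eq, hS.unip l m _ _ _ (by simp) (by simp) (by simp) _ _ t1_factor_mem_Ip,
      hS.apply_ZR l m hm, hB]
  · rw [t5_eq, hS.right_inv l m _ hneg, mul_one, hB]
  · rw [t6_eq, hS.right_inv l m _ hneg, hS.apply_Z l m hm, hB]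
  · rw [t7_eq, hS.right_inv l m _ halt, hS.apply_ZRZR l m hm, hB]
  · rw [t8_eq, hS.right_inv l m _ halt, hS.apply_RZR, hB]
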